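/- arXiv:2006.04177 — 2 statements merged into one kernel-verified Lean document; each statement's English description precedes it below -/
import Mathlib

section
/- The sumset L + U equals ℕ \ {F_n − 1 : n ≥ 1}; that is, a natural number m can be written as m = ⌊i·φ⌋ + ⌊j·φ²⌋ with integers i, j ≥ 1 if and only if m + 1 is not a Fibonacci number F_n with n ≥ 1. -/
noncomputable def phi : ℝ := (1 + Real.sqrt 5) / 2

/-- The lower Wythoff set `L = {⌊i·φ⌋ : i ≥ 1}`. -/
def lowerWythoff : Set ℕ := {n | ∃ i : ℕ, 1 ≤ i ∧ n = ⌊(i : ℝ) * phi⌋₊}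

/-- The upper Wythoff set `U = {⌊i·φ²⌋ : i ≥ 1}`. -/
def upperWythoff : Set ℕ := {n | ∃ i : ℕ, 1 ≤ i ∧ n = ⌊(i : ℝ) * phi ^ 2⌋₊}

open Real

/-- Consecutive Fibonacci pairs form a basis of `ℤ²`, compatibly with `(P, i) ↦ i + P * ψ`. -/
theorem exists_fib_coords (n : ℕ) (P i : ℤ) : ∃ u v : ℤ,
    P = u * Nat.fib (n + 1) + v * Nat.fib n ∧
      (i : ℝ) + P * goldenConj = u * goldenConj ^ (n + 1) + v * goldenConj ^ n := by
  induction n with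
  | zero => exact ⟨P, i, by simp, by simp; ring⟩
  | succ n ih =>
    obtain ⟨u, v, h₁, h₂⟩ := ih
    refine ⟨v, u - v, ?_, ?_⟩
    · rw [h₁, Nat.fib_add_two]; push_cast; ring
    · rw [h₂]; push_cast
      linear_combination (-(v : ℝ) * goldenConj ^ n) * goldenConj_sq

/-- Bounds sharp enough to decide the numerical comparisons below. -/
theorem goldenConj_bounds : -(5 / 8 : ℝ) < goldenConj ∧ goldenConj < -(3 / 5) := by
  have h := goldenConj_sq
  have h₁ := goldenConj_neg
  constructor <;> nlinarith

/-- One-sided best approximation: `ψ ^ (n + 1)` is not improved by multipliers up to the next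
Fibonacci number. -/
theorem eq_fib_of_approx {n : ℕ} {P i : ℤ} {q : ℝ} (hP : 0 ≤ P)
    (hlt : P < Nat.fib (n + 2)) (hq : 0 < q) (hq₁ : q ≤ 1)
    (h : (i : ℝ) + P * goldenConj = q * goldenConj ^ (n + 1)) :
    P = Nat.fib (n + 1) ∧ q = 1 := by
  obtain ⟨u, v, h₁, h₂⟩ := exists_fib_coords n P i
  obtain ⟨hl, hr⟩ := goldenConj_bounds
  have hf : (0 : ℤ) < Nat.fib (n + 1) := by exact_mod_cast Nat.fib_pos.2 n.succ_pos
  have hf' : (0 : ℤ) ≤ Nat.fib n := by positivity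
  rw [Nat.fib_add_two] at hlt
  push_cast at hlt
  have e : u * goldenConj + v = q * goldenConj := by
    have := pow_ne_zero n goldenConj_ne_zero
    apply mul_right_cancel₀ this
    linear_combination h - h₂
  rcases lt_trichotomy v 0 with hv | hv | hv
  · have : (v : ℝ) ≤ -1 := by exact_mod_cast Int.le_sub_one_of_lt hv
    have hu : (u : ℝ) < 0 := by nlinarith
    have hu : u < 0 := by exact_mod_cast hu
    nlinarith
  · subst hv
    have : (u : ℝ) = q := mul_right_cancel₀ goldenConj_ne_zero (by simpa using e)
    have hu : 0 < u := by rw [← this] at hq; exact_mod_cast hq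
    have hu' : u ≤ 1 := by rw [← this] at hq₁; exact_mod_cast hq₁
    obtain rfl : u = 1 := by omega
    exact ⟨by simpa using h₁, by simpa using this.symm⟩
  · have : (1 : ℝ) ≤ v := by exact_mod_cast hv
    have hu : (1 : ℝ) < u := by nlinarith
    have hu : 1 < u := by exact_mod_cast hu
    nlinarith

theorem approx_lt_fib {n : ℕ} {P i : ℤ} {q : ℝ} (hgt : Nat.fib (n + 1) < P)
    (hlt : P < Nat.fib (n + 2)) (hq : 0 < q) (hq₁ : q ≤ 1)
    (h : (i : ℝ) + P * goldenConj = q * goldenConj ^ n) : False := by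
  obtain ⟨u, v, h₁, h₂⟩ := exists_fib_coords n P i
  obtain ⟨hl, hr⟩ := goldenConj_bounds
  have hf : (0 : ℤ) < Nat.fib (n + 1) := by exact_mod_cast Nat.fib_pos.2 n.succ_pos
  have hf' : (0 : ℤ) ≤ Nat.fib n := by positivity
  have hle : (Nat.fib n : ℤ) ≤ Nat.fib (n + 1) := by exact_mod_cast Nat.fib_le_fib_succ
  rw [Nat.fib_add_two] at hlt
  push_cast at hlt
  have e : u * goldenConj + v = q := by
    have := pow_ne_zero n goldenConj_ne_zero
    apply mul_right_cancel₀ this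
    linear_combination h - h₂
  rcases lt_trichotomy u 0 with hu | hu | hu
  · have : (u : ℝ) ≤ -1 := by exact_mod_cast Int.le_sub_one_of_lt hu
    have hv : (v : ℝ) < 1 := by nlinarith
    have hv : v < 1 := by exact_mod_cast hv
    nlinarith
  · subst hu
    have : (v : ℝ) = q := by simpa using e
    have hv : v ≤ 1 := by rw [← this] at hq₁; exact_mod_cast hq₁
    nlinarith
  · have : (1 : ℝ) ≤ u := by exact_mod_cast hu
    have hv : (0 : ℝ) < v := by nlinarith
    have hv : 0 < v := by exact_mod_cast hv
    nlinarith

theorem int_add_mul_goldenConj_ne_zero (p : ℤ) {q : ℤ} (hq : q ≠ 0) :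
    (p : ℝ) + q * goldenConj ≠ 0 := by
  have h := (goldenConj_irrational.intCast_mul hq).intCast_add p
  exact h.ne_zero

theorem phi_eq_goldenRatio : phi = goldenRatio := rfl

theorem mem_lowerWythoff_iff (a : ℕ) :
    a ∈ lowerWythoff ↔ ∃ i : ℤ, goldenConj < i + ((a : ℤ) + 1 : ℤ) * goldenConj ∧
      (i : ℝ) + ((a : ℤ) + 1 : ℤ) * goldenConj < 0 := by
  have hφ := goldenRatio_pos
  have hψ := goldenConj_neg
  have hm := goldenRatio_mul_goldenConj
  have ha : (0 : ℝ) ≤ a := a.cast_nonneg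
  simp only [lowerWythoff, Set.mem_ofPred_eq, phi_eq_goldenRatio]
  push_cast
  constructor
  · rintro ⟨i, hi, h⟩
    have h := (Nat.floor_eq_iff (by positivity)).1 h.symm
    refine ⟨i, ?_, ?_⟩
    · have hne : (i : ℝ) + a * goldenConj ≠ 0 := by
        rcases eq_or_ne a 0 with rfl | h0
        · simpa using by omega
        · simpa using int_add_mul_goldenConj_ne_zero i (q := a) (by exact_mod_cast h0)
      have : 0 ≤ (i : ℝ) + a * goldenConj := by nlinarith [h.1]
      push_cast
      linarith [lt_of_le_of_ne this hne.symm]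
    · push_cast
      nlinarith [h.2]
  · rintro ⟨i, h₁, h₂⟩
    have hi : (0 : ℝ) < i := by nlinarith
    have hi : 0 < i := by exact_mod_cast hi
    lift i to ℕ using hi.le
    push_cast at *
    refine ⟨i, by omega, ((Nat.floor_eq_iff (by positivity)).2 ⟨?_, ?_⟩).symm⟩ <;> nlinarith

theorem mem_upperWythoff_iff (b : ℕ) :
    b ∈ upperWythoff ↔ ∃ i : ℤ, 0 < i + ((b : ℤ) + 1 : ℤ) * goldenConj ∧
      (i : ℝ) + ((b : ℤ) + 1 : ℤ) * goldenConj < goldenConj ^ 2 := by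
  have hφ := goldenRatio_pos
  have hψ := goldenConj_sq
  have hpos : 0 < goldenConj ^ 2 := by have := goldenConj_ne_zero; positivity
  have hm : goldenRatio ^ 2 * goldenConj ^ 2 = 1 := by
    rw [← mul_pow, goldenRatio_mul_goldenConj]; norm_num
  have hφ2 : 0 < goldenRatio ^ 2 := by positivity
  have hb : (0 : ℝ) ≤ b := b.cast_nonneg
  simp only [upperWythoff, Set.mem_ofPred_eq, phi_eq_goldenRatio]
  push_cast
  constructor
  · rintro ⟨j, hj, h⟩
    have h := (Nat.floor_eq_iff (by positivity)).1 h.symm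
    refine ⟨b + 1 - j, ?_, ?_⟩
    · have : (j : ℝ) < (b + 1) * goldenConj ^ 2 := by nlinarith [h.2]
      push_cast
      nlinarith
    · have hne : (j : ℝ) - b * goldenConj ^ 2 ≠ 0 := by
        rw [hψ]
        rcases eq_or_ne b 0 with rfl | h0
        · simpa using by omega
        · have := int_add_mul_goldenConj_ne_zero (j - b) (q := -b) (by simpa using h0)
          push_cast at this
          contrapose! this
          linarith
      have : 0 ≤ (j : ℝ) - b * goldenConj ^ 2 := by nlinarith [h.1]
      have := lt_of_le_of_ne this hne.symm
      push_cast
      nlinarith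
  · rintro ⟨i, h₁, h₂⟩
    have e : ((b + 1 - i : ℤ) : ℝ) = b + 1 - i := by push_cast; ring
    have l₁ : (b : ℝ) * goldenConj ^ 2 < (b + 1 - i : ℤ) := by rw [e]; nlinarith
    have l₂ : ((b + 1 - i : ℤ) : ℝ) < (b + 1) * goldenConj ^ 2 := by rw [e]; nlinarith
    generalize (b + 1 - i : ℤ) = j at l₁ l₂
    have hj : (0 : ℝ) < j := by nlinarith
    have hj : 0 < j := by exact_mod_cast hj
    lift j to ℕ using hj.le
    push_cast at *
    refine ⟨j, by omega, ((Nat.floor_eq_iff (by positivity)).2 ⟨?_, ?_⟩).symm⟩ <;> nlinarith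

/-- Splitting `M + 1 = N + K` into multipliers witnessing membership in the two Wythoff sets. -/
theorem exists_add_of_split {m : ℕ} {N : ℕ} (p i : ℤ) (hN : 1 ≤ N) (hNm : N ≤ m + 1)
    (h₁ : goldenConj < i + N * goldenConj) (h₂ : i + N * goldenConj < 0)
    (h₃ : i + N * goldenConj < p + (m + 1 : ℕ) * goldenConj + goldenConj)
    (h₄ : p + (m + 1 : ℕ) * goldenConj + goldenConj < i + N * goldenConj + goldenConj ^ 2) :
    ∃ a ∈ lowerWythoff, ∃ b ∈ upperWythoff, m = a + b := by
  obtain ⟨a, rfl⟩ := Nat.exists_eq_add_of_le' hN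
  obtain ⟨b, rfl⟩ := Nat.exists_eq_add_of_le (Nat.le_of_succ_le_succ hNm)
  refine ⟨a, (mem_lowerWythoff_iff a).2 ⟨i, ?_, ?_⟩, b, (mem_upperWythoff_iff b).2 ⟨p - i, ?_, ?_⟩,
    rfl⟩ <;> push_cast at * <;> linarith

theorem goldenConj_pow_eq (k : ℕ) :
    ∃ i : ℤ, (i : ℝ) + Nat.fib k * goldenConj = goldenConj ^ k := by
  cases k with
  | zero => exact ⟨1, by simp⟩
  | succ k => exact ⟨Nat.fib k, by rw [← goldenConj_mul_fib_succ_add_fib]; push_cast; ring⟩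

theorem exists_odd_even_index (n : ℕ) :
    (∃ k, Odd k ∧ (k = n ∨ k = n + 1)) ∧ ∃ k, Even k ∧ (k = n ∨ k = n + 1) := by
  rcases n.even_or_odd with h | h
  · exact ⟨⟨n + 1, h.add_one, .inr rfl⟩, n, h, .inl rfl⟩
  · exact ⟨⟨n, h, .inl rfl⟩, n + 1, h.add_one, .inr rfl⟩

theorem exists_add_of_between_fib {m n : ℕ} (hgt : Nat.fib (n + 1) < m + 1)
    (hlt : m + 1 < Nat.fib (n + 2)) :
    ∃ a ∈ lowerWythoff, ∃ b ∈ upperWythoff, m = a + b := by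
  obtain ⟨hl, hr⟩ := goldenConj_bounds
  have hsq := goldenConj_sq
  have hf : 0 < Nat.fib (n + 1) := Nat.fib_pos.2 n.succ_pos
  have hle : Nat.fib n ≤ Nat.fib (n + 1) := Nat.fib_le_fib_succ
  have key : ∀ k, (k = n ∨ k = n + 1) → Nat.fib k < m + 1 ∧ ∀ (i : ℤ) (q : ℝ), 0 < q → q ≤ 1 →
      (i : ℝ) + (m + 1 : ℕ) * goldenConj ≠ q * goldenConj ^ k := by
    rintro k (rfl | rfl)
    · exact ⟨by omega, fun i q hq hq₁ h ↦ approx_lt_fib (P := (m + 1 : ℕ)) (i := i)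
        (by exact_mod_cast hgt) (by exact_mod_cast hlt) hq hq₁ (by exact_mod_cast h)⟩
    · refine ⟨hgt, fun i q hq hq₁ h ↦ ?_⟩
      have := (eq_fib_of_approx (P := (m + 1 : ℕ)) (i := i)
        (by positivity) (by exact_mod_cast hlt) hq hq₁ (by exact_mod_cast h)).1
      omega
  obtain ⟨p, hp₀, hp₁⟩ : ∃ p : ℤ, 0 < p + (m + 1 : ℕ) * goldenConj ∧
      p + (m + 1 : ℕ) * goldenConj < 1 := by
    have hne := int_add_mul_goldenConj_ne_zero (-⌊(m + 1 : ℕ) * goldenConj⌋)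
      (q := (m + 1 : ℕ)) (by positivity)
    push_cast at hne
    refine ⟨-⌊(m + 1 : ℕ) * goldenConj⌋, lt_of_le_of_ne ?_ ?_, ?_⟩
    · rw [Int.cast_neg]; linarith [Int.floor_le (((m + 1 : ℕ) : ℝ) * goldenConj)]
    · push_cast; exact hne.symm
    · rw [Int.cast_neg]; linarith [Int.lt_floor_add_one (((m + 1 : ℕ) : ℝ) * goldenConj)]
  obtain ⟨⟨k, hk, hkn⟩, l, hlev, hln⟩ := exists_odd_even_index n
  rcases le_or_gt (p + (m + 1 : ℕ) * goldenConj) (goldenConj ^ 2) with hA | hA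
  · obtain ⟨hfl, hne⟩ := key l hln
    obtain ⟨i, hi⟩ := goldenConj_pow_eq l
    have hpow : 0 < goldenConj ^ l := hlev.pow_pos goldenConj_ne_zero
    have hlt' : goldenConj ^ l < p + (m + 1 : ℕ) * goldenConj := by
      by_contra! h
      exact hne p _ (div_pos hp₀ hpow) ((div_le_one hpow).2 h) (div_mul_cancel₀ _ hpow.ne').symm
    apply exists_add_of_split (N := Nat.fib l + 1) p i (by omega) (by omega) <;>
      push_cast at * <;> linarith
  rcases le_or_gt (-goldenConj) (p + (m + 1 : ℕ) * goldenConj) with hB | hB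
  · obtain ⟨hfl, hne⟩ := key k hkn
    obtain ⟨i, hi⟩ := goldenConj_pow_eq k
    have hpow : goldenConj ^ k < 0 := hk.pow_neg goldenConj_neg
    have hlt' : p + (m + 1 : ℕ) * goldenConj - 1 < goldenConj ^ k := by
      by_contra! h
      refine hne (p - 1) ((p + (m + 1 : ℕ) * goldenConj - 1) / goldenConj ^ k)
        (div_pos_of_neg_of_neg (by linarith) hpow) ((div_le_one_of_neg hpow).2 h) ?_
      rw [div_mul_cancel₀ _ hpow.ne]; push_cast; ring
    apply exists_add_of_split (N := Nat.fib k) p i (Nat.fib_pos.2 hk.pos) (by omega) <;>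
      push_cast at * <;> linarith
  · apply exists_add_of_split (N := 2) p 1 (by omega) (by omega) <;>
      push_cast at * <;> linarith

theorem add_add_one_ne_fib {a b : ℕ} (ha : a ∈ lowerWythoff) (hb : b ∈ upperWythoff)
    (n : ℕ) : a + b + 1 ≠ Nat.fib (n + 1) := by
  intro h
  obtain ⟨i, hi₁, hi₂⟩ := (mem_lowerWythoff_iff a).1 ha
  obtain ⟨j, hj₁, hj₂⟩ := (mem_upperWythoff_iff b).1 hb
  obtain ⟨hl, hr⟩ := goldenConj_bounds
  have hsq := goldenConj_sq
  obtain ⟨p, hp⟩ := goldenConj_pow_eq (n + 1)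
  rw [← h] at hp
  have hle : Nat.fib (n + 1) ≤ Nat.fib (n + 2) := Nat.fib_le_fib_succ
  push_cast at *
  have habs : |goldenConj ^ (n + 1)| < 1 := by
    rw [abs_pow]
    exact pow_lt_one₀ (abs_nonneg _) (by rw [abs_lt]; constructor <;> linarith) n.succ_ne_zero
  obtain ⟨hlo, hhi⟩ := abs_lt.1 habs
  rcases (n + 1).even_or_odd with hn | hn
  · have hpow : 0 < goldenConj ^ (n + 1) := hn.pow_pos goldenConj_ne_zero
    have h₁ : ((i + j - p : ℤ) : ℝ) < 1 := by push_cast; linarith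
    have h₂ : (-1 : ℝ) < (i + j - p : ℤ) := by push_cast; linarith
    have hij : i + j = p := by
      have h₁ : i + j - p < 1 := by exact_mod_cast h₁
      have h₂ : -1 < i + j - p := by exact_mod_cast h₂
      omega
    have hij : (i : ℝ) + j = p := by exact_mod_cast hij
    have hlt : (i : ℝ) + a * goldenConj < goldenConj ^ (n + 1) := by linarith
    have := (eq_fib_of_approx (n := n) (P := a) (i := i)
      (q := (i + a * goldenConj) / goldenConj ^ (n + 1)) (by positivity) (by omega)
      (div_pos (by linarith) hpow) ((div_le_one hpow).2 hlt.le)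
      (by rw [div_mul_cancel₀ _ hpow.ne']; push_cast; rfl)).1
    omega
  · have hpow : goldenConj ^ (n + 1) < 0 := hn.pow_neg goldenConj_neg
    have h₁ : ((i + j - p : ℤ) : ℝ) < 2 := by push_cast; linarith
    have h₂ : (0 : ℝ) < (i + j - p : ℤ) := by push_cast; linarith
    have hij : i + j = p + 1 := by
      have h₁ : i + j - p < 2 := by exact_mod_cast h₁
      have h₂ : 0 < i + j - p := by exact_mod_cast h₂
      omega
    have hij : (i : ℝ) + j = p + 1 := by exact_mod_cast hij
    have hlt : goldenConj ^ (n + 1) < (i : ℝ) + (a + 1) * goldenConj := by linarith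
    have hlt2 : a + 1 < Nat.fib (n + 2) := by
      rcases n with _ | n
      · exfalso
        have ha0 : a = 0 := by simp at h; omega
        subst ha0
        simp at hi₁ hi₂
        have : (1 : ℝ) ≤ i := by exact_mod_cast hi₁
        linarith
      · have : 0 < Nat.fib (n + 1) := Nat.fib_pos.2 n.succ_pos
        have := Nat.fib_add_two (n := n + 1)
        omega
    have := (eq_fib_of_approx (n := n) (P := a + 1) (i := i)
      (q := (i + (a + 1) * goldenConj) / goldenConj ^ (n + 1)) (by positivity)
      (by exact_mod_cast hlt2)
      (div_pos_of_neg_of_neg (by linarith) hpow) ((div_le_one_of_neg hpow).2 hlt.le)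
      (by rw [div_mul_cancel₀ _ hpow.ne]; push_cast; rfl)).2
    rw [div_eq_one_iff_eq hpow.ne] at this
    linarith

/-- Theorem 3.5(i): `L + U = ℕ \ {F_k - 1 : k ≥ 1}`. -/
theorem lower_add_upper (m : ℕ) :
    (∃ a ∈ lowerWythoff, ∃ b ∈ upperWythoff, m = a + b) ↔
      ¬∃ k : ℕ, 1 ≤ k ∧ m + 1 = Nat.fib k := by
  constructor
  · rintro ⟨a, ha, b, hb, rfl⟩ ⟨k, hk, h⟩
    obtain ⟨n, rfl⟩ := Nat.exists_eq_add_of_le' hk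
    exact add_add_one_ne_fib ha hb n h
  · intro h
    have hle := Nat.fib_greatestFib_le (m + 1)
    have hlt := Nat.lt_fib_greatestFib_add_one (m + 1)
    rcases hg : Nat.greatestFib (m + 1) with _ | n
    · simp [hg] at hlt
    · rw [hg] at hle hlt
      exact exists_add_of_between_fib (hle.lt_of_ne fun e ↦ h ⟨n + 1, by omega, e.symm⟩) hlt
end

section
/- The sumset L₀ + U + U equals ℕ \ {0, 1, 2, 3, 6}; that is, a natural number n can be written as n = a + b + c with a ∈ L₀ and b, c ∈ U if and only if n ∉ {0, 1, 2, 3, 6}. -/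
lemma phi_gt : 1.6 < phi := by
  have h : (2.2 : ℝ) < Real.sqrt 5 := Real.lt_sqrt_of_sq_lt (by norm_num)
  unfold phi
  linarith

lemma phi_lt : phi < 1.65 := by
  have h : Real.sqrt 5 < 2.3 := (Real.sqrt_lt' (by norm_num)).2 (by norm_num)
  unfold phi
  linarith

lemma phi_sq : phi ^ 2 = phi + 1 := by
  have h : Real.sqrt 5 ^ 2 = 5 := Real.sq_sqrt (by norm_num)
  unfold phi
  linarith

lemma one_mem_lowerWythoff : 1 ∈ lowerWythoff := by
  refine ⟨1, le_rfl, ((Nat.floor_eq_iff ?_).2 ⟨?_, ?_⟩).symm⟩ <;> push_cast <;>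
    linarith [phi_gt, phi_lt]

lemma two_mem_upperWythoff : 2 ∈ upperWythoff := by
  refine ⟨1, le_rfl, ((Nat.floor_eq_iff ?_).2 ⟨?_, ?_⟩).symm⟩ <;> push_cast <;>
    linarith [phi_gt, phi_lt, phi_sq]

lemma five_mem_upperWythoff : 5 ∈ upperWythoff := by
  refine ⟨2, one_le_two, ((Nat.floor_eq_iff ?_).2 ⟨?_, ?_⟩).symm⟩ <;> push_cast <;>
    linarith [phi_gt, phi_lt, phi_sq]

lemma seven_mem_upperWythoff : 7 ∈ upperWythoff := by
  refine ⟨3, by norm_num, ((Nat.floor_eq_iff ?_).2 ⟨?_, ?_⟩).symm⟩ <;> push_cast <;>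
    linarith [phi_gt, phi_lt, phi_sq]

lemma eq_one_or_three_le_of_mem_lowerWythoff {a : ℕ} (ha : a ∈ lowerWythoff) :
    a = 1 ∨ 3 ≤ a := by
  obtain ⟨i, hi, rfl⟩ := ha
  rcases hi.eq_or_lt with rfl | hi
  · left
    refine (Nat.floor_eq_iff ?_).2 ⟨?_, ?_⟩ <;> push_cast <;> linarith [phi_gt, phi_lt]
  · right
    have hi' : (2 : ℝ) ≤ i := by exact_mod_cast hi
    refine Nat.le_floor ?_
    push_cast
    nlinarith [phi_gt]

lemma eq_two_or_five_le_of_mem_upperWythoff {b : ℕ} (hb : b ∈ upperWythoff) :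
    b = 2 ∨ 5 ≤ b := by
  obtain ⟨i, hi, rfl⟩ := hb
  rw [phi_sq]
  rcases hi.eq_or_lt with rfl | hi
  · left
    refine (Nat.floor_eq_iff ?_).2 ⟨?_, ?_⟩ <;> push_cast <;> linarith [phi_gt, phi_lt]
  · right
    have hi' : (2 : ℝ) ≤ i := by exact_mod_cast hi
    refine Nat.le_floor ?_
    push_cast
    nlinarith [phi_gt]

/-- Consecutive elements of the lower Wythoff set differ by at most two. -/
lemma mem_lowerWythoff_or_succ_mem (m : ℕ) : m ∈ lowerWythoff ∨ m + 1 ∈ lowerWythoff := by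
  induction m with
  | zero => exact Or.inr one_mem_lowerWythoff
  | succ m ih =>
    rcases ih with ⟨i, -, hm⟩ | h
    · have hphi := phi_gt
      have hphi' := phi_lt
      have hpos : 0 ≤ (i : ℝ) * phi := by positivity
      have hle := Nat.floor_le hpos
      have hlt := Nat.lt_floor_add_one ((i : ℝ) * phi)
      rw [← hm] at hle hlt
      have hlow : m + 1 ≤ ⌊((i + 1 : ℕ) : ℝ) * phi⌋₊ := by
        refine Nat.le_floor ?_
        push_cast
        linarith
      have hupp : ⌊((i + 1 : ℕ) : ℝ) * phi⌋₊ < m + 3 := by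
        refine (Nat.floor_lt (by positivity)).2 ?_
        push_cast
        linarith
      have hmem : ⌊((i + 1 : ℕ) : ℝ) * phi⌋₊ ∈ lowerWythoff := ⟨i + 1, by omega, rfl⟩
      have hcases : ⌊((i + 1 : ℕ) : ℝ) * phi⌋₊ = m + 1 ∨
          ⌊((i + 1 : ℕ) : ℝ) * phi⌋₊ = m + 1 + 1 := by omega
      rcases hcases with h | h <;> rw [h] at hmem
      · exact Or.inl hmem
      · exact Or.inr hmem
    · exact Or.inl h

/-- Theorem 3.7(ii): `L₀ + U + U = ℕ \ {0, 1, 2, 3, 6}`. -/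
theorem lower0_add_upper_add_upper (n : ℕ) :
    (∃ a ∈ lowerWythoff ∪ {0}, ∃ b ∈ upperWythoff, ∃ c ∈ upperWythoff, n = a + b + c) ↔
      n ∉ ({0, 1, 2, 3, 6} : Set ℕ) := by
  simp only [Set.mem_insert_iff, Set.mem_singleton_iff]
  constructor
  · rintro ⟨a, ha, b, hb, c, hc, rfl⟩
    have hb' := eq_two_or_five_le_of_mem_upperWythoff hb
    have hc' := eq_two_or_five_le_of_mem_upperWythoff hc
    rcases ha with ha | rfl
    · have ha' := eq_one_or_three_le_of_mem_lowerWythoff ha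
      omega
    · omega
  · intro hn
    have h0 : 0 ∈ lowerWythoff ∪ {0} := Or.inr rfl
    have h1 : 1 ∈ lowerWythoff ∪ {0} := Or.inl one_mem_lowerWythoff
    have h2 := two_mem_upperWythoff
    have h5 := five_mem_upperWythoff
    have h7 := seven_mem_upperWythoff
    rcases lt_or_ge n 10 with hlt | hge
    · have hcases : n = 4 ∨ n = 5 ∨ n = 7 ∨ n = 8 ∨ n = 9 := by omega
      rcases hcases with rfl | rfl | rfl | rfl | rfl
      · exact ⟨0, h0, 2, h2, 2, h2, rfl⟩
      · exact ⟨1, h1, 2, h2, 2, h2, rfl⟩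
      · exact ⟨0, h0, 2, h2, 5, h5, rfl⟩
      · exact ⟨1, h1, 2, h2, 5, h5, rfl⟩
      · exact ⟨0, h0, 2, h2, 7, h7, rfl⟩
    · rcases mem_lowerWythoff_or_succ_mem (n - 10) with h | h
      · exact ⟨_, Or.inl h, 5, h5, 5, h5, by omega⟩
      · exact ⟨_, Or.inl h, 2, h2, 7, h7, by omega⟩
end
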